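/- Let k ≥ 1, v = 2k, and S = F_2[U] the polynomial ring over the field F_2 with two elements. Let A be the free S-module with basis {e, a, b, c, z_0} ∪ {w_r^s : 1 ≤ r ≤ v, s ∈ {1,2}}, with S-linear differential ∂ given by ∂a = b + c, ∂b = ∂c = U·e, ∂z_0 = w_1^1 + w_1^2, ∂w_r^s = U·w_{r-1}^s + w_{r+1}^s for even r with 0 < r < v, ∂w_v^s = U·w_{v-1}^s, and ∂ = 0 on e and on w_r^s for odd r. Then ∂ ∘ ∂ = 0 and the homology ker(∂)/range(∂) is isomorphic as an S-module to F_2[U] ⊕ F_2[U]/(U^k) ⊕ F_2[U]/(U). -/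

import Mathlib

/- The homology of the subcomplex A₀⁻ of the model complex C₁ is
F₂[U] ⊕ F₂[U]/(U^k) ⊕ F₂[U]/(U). -/

/-- `S2` is the polynomial ring `F₂[U]` (with `U = Polynomial.X`). -/
abbrev S2 : Type := Polynomial (ZMod 2)

/-- Basis `{e, a, b, c, z_0} ∪ {w_r^s : 1 ≤ r ≤ v, s ∈ {1,2}}` of the subcomplex `A₀⁻`
of the model complex `C₁`. -/
inductive AB (v : ℕ) : Type
  | a | b | c | e | z0 | w (s : Fin 2) (r : Fin v)
  deriving DecidableEq

/-- The basis vector `w_r^{s+1}` for `1 ≤ r ≤ v`, extended by `0` outside that range. -/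
noncomputable def wS (v : ℕ) (s : Fin 2) (r : ℕ) : AB v → S2 :=
  if h : 1 ≤ r ∧ r ≤ v then Pi.single (AB.w s ⟨r - 1, by omega⟩) 1 else 0

/-- The differential of the subcomplex `A₀⁻`; since `wS` vanishes out of range, the formula for
even `r` also covers `r = v`. -/
structure IsModelDifferential (k : ℕ) (d : (AB (2 * k) → S2) →ₗ[S2] (AB (2 * k) → S2)) :
    Prop where
  map_a : d (Pi.single AB.a 1) = Pi.single AB.b 1 + Pi.single AB.c 1
  map_b : d (Pi.single AB.b 1) = (Polynomial.X : S2) • (Pi.single AB.e 1 : AB (2 * k) → S2)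
  map_c : d (Pi.single AB.c 1) = (Polynomial.X : S2) • (Pi.single AB.e 1 : AB (2 * k) → S2)
  map_e : d (Pi.single AB.e 1) = 0
  map_z0 : d (Pi.single AB.z0 1) = wS (2 * k) 0 1 + wS (2 * k) 1 1
  map_odd : ∀ s : Fin 2, ∀ i < k, d (wS (2 * k) s (2 * i + 1)) = 0
  map_even : ∀ s : Fin 2, ∀ i < k, d (wS (2 * k) s (2 * i + 2)) =
    (Polynomial.X : S2) • wS (2 * k) s (2 * i + 1) + wS (2 * k) s (2 * i + 3)

/-- The coordinate of `w_r^{s+1}`, extended by `0` outside `1 ≤ r ≤ v`. -/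
noncomputable def wCoord (v : ℕ) (s : Fin 2) (r : ℕ) : (AB v → S2) →ₗ[S2] S2 :=
  if h : 1 ≤ r ∧ r ≤ v then LinearMap.proj (AB.w s ⟨r - 1, by omega⟩) else 0

theorem add_self_eq_zero_of_module_S2 {M : Type*} [AddCommGroup M] [Module S2 M] (x : M) :
    x + x = 0 := by
  rw [← one_smul S2 x, ← add_smul, CharTwo.add_self_eq_zero, zero_smul]

theorem neg_eq_self_of_module_S2 {M : Type*} [AddCommGroup M] [Module S2 M] (x : M) : -x = x :=
  neg_eq_of_add_eq_zero_left (add_self_eq_zero_of_module_S2 x)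

theorem wS_of_lt {v : ℕ} (s : Fin 2) {r : ℕ} (h : v < r) : wS v s r = 0 :=
  dif_neg (by omega)

theorem wS_succ {v : ℕ} (s : Fin 2) (j : Fin v) : wS v s (j + 1) = Pi.single (AB.w s j) 1 :=
  dif_pos (by omega)

section Coordinates

variable (v : ℕ) (s : Fin 2) (r : ℕ)

@[simp] theorem wS_apply_a : wS v s r AB.a = 0 := by unfold wS; split_ifs <;> simp
@[simp] theorem wS_apply_b : wS v s r AB.b = 0 := by unfold wS; split_ifs <;> simp
@[simp] theorem wS_apply_c : wS v s r AB.c = 0 := by unfold wS; split_ifs <;> simp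
@[simp] theorem wS_apply_e : wS v s r AB.e = 0 := by unfold wS; split_ifs <;> simp
@[simp] theorem wS_apply_z0 : wS v s r AB.z0 = 0 := by unfold wS; split_ifs <;> simp

@[simp] theorem wCoord_single_a (p : S2) : wCoord v s r (Pi.single AB.a p) = 0 := by
  unfold wCoord; split_ifs <;> simp
@[simp] theorem wCoord_single_b (p : S2) : wCoord v s r (Pi.single AB.b p) = 0 := by
  unfold wCoord; split_ifs <;> simp
@[simp] theorem wCoord_single_c (p : S2) : wCoord v s r (Pi.single AB.c p) = 0 := by
  unfold wCoord; split_ifs <;> simp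
@[simp] theorem wCoord_single_e (p : S2) : wCoord v s r (Pi.single AB.e p) = 0 := by
  unfold wCoord; split_ifs <;> simp
@[simp] theorem wCoord_single_z0 (p : S2) : wCoord v s r (Pi.single AB.z0 p) = 0 := by
  unfold wCoord; split_ifs <;> simp

theorem wCoord_wS (s' : Fin 2) (r' : ℕ) :
    wCoord v s r (wS v s' r') = if s = s' ∧ r = r' ∧ 1 ≤ r ∧ r ≤ v then 1 else 0 := by
  unfold wCoord wS
  by_cases h : 1 ≤ r ∧ r ≤ v <;> by_cases h' : 1 ≤ r' ∧ r' ≤ v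
  · simp only [dif_pos h, dif_pos h', LinearMap.proj_apply, Pi.single_apply, AB.w.injEq,
      Fin.mk.injEq]
    congr 1
    simp only [eq_iff_iff]
    constructor <;> rintro ⟨h₁, h₂⟩ <;> refine ⟨h₁, ?_⟩ <;> omega
  · rw [dif_neg h', map_zero, if_neg]
    rintro ⟨-, rfl, h₁⟩
    exact h' h₁
  · rw [dif_neg h, LinearMap.zero_apply, if_neg]
    rintro ⟨-, -, h₁⟩
    exact h h₁
  · rw [dif_neg h, LinearMap.zero_apply, if_neg]
    rintro ⟨-, -, h₁⟩
    exact h h₁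

end Coordinates

instance AB.instFinite (v : ℕ) : Finite (AB v) :=
  Finite.of_surjective
    (fun t : Option (Option (Option (Option (Option (Fin 2 × Fin v))))) => match t with
      | none => AB.a
      | some none => AB.b
      | some (some none) => AB.c
      | some (some (some none)) => AB.e
      | some (some (some (some none))) => AB.z0
      | some (some (some (some (some p)))) => AB.w p.1 p.2)
    (by
      rintro (_ | _ | _ | _ | _ | ⟨s, r⟩)
      exacts [⟨none, rfl⟩, ⟨some none, rfl⟩, ⟨some (some none), rfl⟩,
        ⟨some (some (some none)), rfl⟩, ⟨some (some (some (some none))), rfl⟩,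
        ⟨some (some (some (some (some (s, r))))), rfl⟩])

theorem AB.linearMap_ext {k : ℕ} {M : Type*} [AddCommGroup M] [Module S2 M]
    {f g : (AB (2 * k) → S2) →ₗ[S2] M}
    (ha : f (Pi.single AB.a 1) = g (Pi.single AB.a 1))
    (hb : f (Pi.single AB.b 1) = g (Pi.single AB.b 1))
    (hc : f (Pi.single AB.c 1) = g (Pi.single AB.c 1))
    (he : f (Pi.single AB.e 1) = g (Pi.single AB.e 1))
    (hz : f (Pi.single AB.z0 1) = g (Pi.single AB.z0 1))
    (hodd : ∀ s, ∀ i < k, f (wS (2 * k) s (2 * i + 1)) = g (wS (2 * k) s (2 * i + 1)))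
    (heven : ∀ s, ∀ i < k, f (wS (2 * k) s (2 * i + 2)) = g (wS (2 * k) s (2 * i + 2))) :
    f = g := by
  refine LinearMap.pi_ext' fun t => LinearMap.ext_ring ?_
  rcases t with _ | _ | _ | _ | _ | ⟨s, r⟩
  · exact ha
  · exact hb
  · exact hc
  · exact he
  · exact hz
  · simp only [LinearMap.comp_apply, LinearMap.single_apply]
    rw [← wS_succ]
    obtain ⟨i, hi⟩ | ⟨i, hi⟩ := Nat.even_or_odd (r : ℕ)
    · rw [hi, ← two_mul]
      exact hodd s i (by omega)
    · rw [hi]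
      exact heven s i (by omega)

/-- The functional sending `w_{2i+1}^s` to `U^i` and every other basis vector to `0`. -/
noncomputable def oddWeight (k : ℕ) : (AB (2 * k) → S2) →ₗ[S2] S2 :=
  ∑ s : Fin 2, ∑ i ∈ Finset.range k, (Polynomial.X : S2) ^ i • wCoord (2 * k) s (2 * i + 1)

@[simp] theorem oddWeight_single_a (k : ℕ) : oddWeight k (Pi.single AB.a 1) = 0 := by
  simp [oddWeight]
@[simp] theorem oddWeight_single_b (k : ℕ) : oddWeight k (Pi.single AB.b 1) = 0 := by
  simp [oddWeight]
@[simp] theorem oddWeight_single_c (k : ℕ) : oddWeight k (Pi.single AB.c 1) = 0 := by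
  simp [oddWeight]
@[simp] theorem oddWeight_single_e (k : ℕ) : oddWeight k (Pi.single AB.e 1) = 0 := by
  simp [oddWeight]
@[simp] theorem oddWeight_single_z0 (k : ℕ) : oddWeight k (Pi.single AB.z0 1) = 0 := by
  simp [oddWeight]

theorem oddWeight_odd {k : ℕ} (s : Fin 2) {i : ℕ} (hi : i < k) :
    oddWeight k (wS (2 * k) s (2 * i + 1)) = Polynomial.X ^ i := by
  simp only [oddWeight, LinearMap.sum_apply, LinearMap.smul_apply, wCoord_wS, smul_eq_mul]
  rw [Finset.sum_eq_single s, Finset.sum_eq_single i]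
  · rw [if_pos (by omega), mul_one]
  · intro j _ hj
    rw [if_neg (by omega), mul_zero]
  · intro h
    exact absurd (Finset.mem_range.2 hi) h
  · intro t _ ht
    exact Finset.sum_eq_zero fun j _ => by rw [if_neg (fun h => ht h.1), mul_zero]
  · simp

theorem oddWeight_even {k : ℕ} (s : Fin 2) (i : ℕ) :
    oddWeight k (wS (2 * k) s (2 * i + 2)) = 0 := by
  simp only [oddWeight, LinearMap.sum_apply, LinearMap.smul_apply, wCoord_wS, smul_eq_mul]
  refine Finset.sum_eq_zero fun t _ => Finset.sum_eq_zero fun j _ => ?_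
  rw [if_neg (by omega), mul_zero]

/-- The map `x ↦ (x_{w_v^1}, ∑ U^i x_{w_{2i+1}^s}, x_e)` inducing the isomorphism on homology. -/
noncomputable def homologyInvariant (k : ℕ) : (AB (2 * k) → S2) →ₗ[S2]
    (S2 × (S2 ⧸ Submodule.span S2 {(Polynomial.X : S2) ^ k}) ×
      (S2 ⧸ Submodule.span S2 {(Polynomial.X : S2)})) :=
  (wCoord (2 * k) 0 (2 * k)).prod
    ((Submodule.mkQ _ ∘ₗ oddWeight k).prod (Submodule.mkQ _ ∘ₗ LinearMap.proj AB.e))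

theorem homologyInvariant_apply (k : ℕ) (x : AB (2 * k) → S2) :
    homologyInvariant k x = (wCoord (2 * k) 0 (2 * k) x,
      Submodule.Quotient.mk (oddWeight k x), Submodule.Quotient.mk (x AB.e)) :=
  rfl

theorem homologyInvariant_eq_zero_iff {k : ℕ} {x : AB (2 * k) → S2} :
    homologyInvariant k x = 0 ↔ wCoord (2 * k) 0 (2 * k) x = 0 ∧
      oddWeight k x ∈ Submodule.span S2 {(Polynomial.X : S2) ^ k} ∧
      x AB.e ∈ Submodule.span S2 {(Polynomial.X : S2)} := by
  rw [homologyInvariant_apply, ← Submodule.Quotient.mk_eq_zero, ← Submodule.Quotient.mk_eq_zero,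
    Prod.mk_eq_zero, Prod.mk_eq_zero]

/-- The cycle generating the free part of the homology. -/
noncomputable def freeCycle (k : ℕ) : AB (2 * k) → S2 :=
  (Polynomial.X : S2) ^ k • Pi.single AB.z0 1 +
    ∑ s : Fin 2, ∑ i ∈ Finset.range k,
      (Polynomial.X : S2) ^ (k - (i + 1)) • wS (2 * k) s (2 * i + 2)

theorem wCoord_freeCycle {k : ℕ} (hk : 1 ≤ k) : wCoord (2 * k) 0 (2 * k) (freeCycle k) = 1 := by
  simp only [freeCycle, map_add, map_smul, map_sum, wCoord_single_z0, wCoord_wS, smul_eq_mul,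
    mul_zero, zero_add]
  rw [Finset.sum_eq_single 0, Finset.sum_eq_single (k - 1)]
  · rw [if_pos (by omega), mul_one, Nat.sub_add_cancel hk, Nat.sub_self, pow_zero]
  · intro j _ hj
    rw [if_neg (by omega), mul_zero]
  · intro h
    exact absurd (Finset.mem_range.2 (by omega)) h
  · intro t _ ht
    exact Finset.sum_eq_zero fun j _ => by rw [if_neg (fun h => ht h.1.symm), mul_zero]
  · simp

theorem oddWeight_freeCycle (k : ℕ) : oddWeight k (freeCycle k) = 0 := by
  simp [freeCycle, oddWeight_even]

theorem freeCycle_apply_e (k : ℕ) : freeCycle k AB.e = 0 := by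
  simp [freeCycle]

namespace IsModelDifferential

variable {k : ℕ} {d : (AB (2 * k) → S2) →ₗ[S2] (AB (2 * k) → S2)}

theorem map_wS_two_mul_add_one (h : IsModelDifferential k d) (s : Fin 2) (i : ℕ) :
    d (wS (2 * k) s (2 * i + 1)) = 0 := by
  by_cases hi : i < k
  · exact h.map_odd s i hi
  · rw [wS_of_lt s (by omega), map_zero]

theorem comp_self (h : IsModelDifferential k d) : d ∘ₗ d = 0 := by
  have h1 : ∀ s, d (wS (2 * k) s 1) = 0 := fun s => h.map_wS_two_mul_add_one s 0
  refine AB.linearMap_ext ?_ ?_ ?_ ?_ ?_ (fun s i hi => ?_) (fun s i hi => ?_)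
  · simp [h.map_a, h.map_b, h.map_c, add_self_eq_zero_of_module_S2]
  · simp [h.map_b, h.map_e]
  · simp [h.map_c, h.map_e]
  · simp [h.map_e]
  · simp [h.map_z0, h1]
  · simp [h.map_odd s i hi]
  · have h3 := h.map_wS_two_mul_add_one s (i + 1)
    rw [show 2 * (i + 1) + 1 = 2 * i + 3 by ring] at h3
    simp [h.map_even s i hi, h.map_odd s i hi, h3]

theorem apply_b (h : IsModelDifferential k d) (x : AB (2 * k) → S2) : d x AB.b = x AB.a := by
  refine LinearMap.congr_fun (f := (LinearMap.proj AB.b : (AB (2 * k) → S2) →ₗ[S2] S2) ∘ₗ d)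
    (g := LinearMap.proj AB.a)
    (AB.linearMap_ext ?_ ?_ ?_ ?_ ?_ (fun s i hi => ?_) (fun s i hi => ?_)) x
  · simp [h.map_a]
  · simp [h.map_b]
  · simp [h.map_c]
  · simp [h.map_e]
  · simp [h.map_z0]
  · simp [h.map_odd s i hi]
  · simp [h.map_even s i hi]

theorem apply_e (h : IsModelDifferential k d) (x : AB (2 * k) → S2) :
    d x AB.e = Polynomial.X * (x AB.b + x AB.c) := by
  suffices hmap : (LinearMap.proj AB.e : (AB (2 * k) → S2) →ₗ[S2] S2) ∘ₗ d =
      (Polynomial.X : S2) •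
        ((LinearMap.proj AB.b : (AB (2 * k) → S2) →ₗ[S2] S2) +
          (LinearMap.proj AB.c : (AB (2 * k) → S2) →ₗ[S2] S2)) by
    simpa only [LinearMap.comp_apply, LinearMap.smul_apply, LinearMap.add_apply,
      LinearMap.proj_apply, smul_eq_mul] using LinearMap.congr_fun hmap x
  refine AB.linearMap_ext ?_ ?_ ?_ ?_ ?_ (fun s i hi => ?_) (fun s i hi => ?_)
  · simp [h.map_a]
  · simp [h.map_b]
  · simp [h.map_c]
  · simp [h.map_e]
  · simp [h.map_z0]
  · simp [h.map_odd s i hi]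
  · simp [h.map_even s i hi]

theorem wCoord_one (h : IsModelDifferential k d) (hk : 1 ≤ k) (s : Fin 2)
    (x : AB (2 * k) → S2) :
    wCoord (2 * k) s 1 (d x) = x AB.z0 + Polynomial.X * wCoord (2 * k) s 2 x := by
  refine LinearMap.congr_fun (f := wCoord (2 * k) s 1 ∘ₗ d)
    (g := LinearMap.proj AB.z0 + (Polynomial.X : S2) • wCoord (2 * k) s 2)
    (AB.linearMap_ext ?_ ?_ ?_ ?_ ?_ (fun t i hi => ?_) (fun t i hi => ?_)) x
  · simp [h.map_a]
  · simp [h.map_b]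
  · simp [h.map_c]
  · simp [h.map_e]
  · have : 1 ≤ 2 * k := by omega
    fin_cases s <;> simp [h.map_z0, wCoord_wS, this]
  · have : 2 ≠ 2 * i + 1 := by omega
    simp [h.map_odd t i hi, wCoord_wS, this]
  · have h1 : 1 ≤ 2 * k := by omega
    have h2 : 2 ≤ 2 * k := by omega
    simp [h.map_even t i hi, wCoord_wS, h1, h2, eq_comm]

theorem wCoord_odd (h : IsModelDifferential k d) (s : Fin 2) {j : ℕ} (hj : j + 1 < k)
    (x : AB (2 * k) → S2) :
    wCoord (2 * k) s (2 * j + 3) (d x) =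
      wCoord (2 * k) s (2 * j + 2) x + Polynomial.X * wCoord (2 * k) s (2 * j + 4) x := by
  refine LinearMap.congr_fun (f := wCoord (2 * k) s (2 * j + 3) ∘ₗ d)
    (g := wCoord (2 * k) s (2 * j + 2) + (Polynomial.X : S2) • wCoord (2 * k) s (2 * j + 4))
    (AB.linearMap_ext ?_ ?_ ?_ ?_ ?_ (fun t i hi => ?_) (fun t i hi => ?_)) x
  · simp [h.map_a]
  · simp [h.map_b]
  · simp [h.map_c]
  · simp [h.map_e]
  · simp [h.map_z0, wCoord_wS]
  · have h1 : 2 * j + 2 ≠ 2 * i + 1 := by omega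
    have h2 : 2 * j + 4 ≠ 2 * i + 1 := by omega
    simp [h.map_odd t i hi, wCoord_wS, h1, h2]
  · have h1 : 2 * j + 2 ≤ 2 * k := by omega
    have h2 : 2 * j + 3 ≤ 2 * k := by omega
    have h3 : 2 * j + 4 ≤ 2 * k := by omega
    have h5 : 1 ≤ 2 * j + 2 := by omega
    have h4 : 2 * j + 3 = 2 * i + 1 ↔ 2 * j + 4 = 2 * i + 2 := by omega
    simp only [LinearMap.comp_apply, h.map_even t i hi, map_add, map_smul, LinearMap.add_apply,
      LinearMap.smul_apply, wCoord_wS, h1, h2, h3, h4, h5]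
    simp [add_comm]

theorem map_freeCycle (h : IsModelDifferential k d) : d (freeCycle k) = 0 := by
  have tele (s : Fin 2) : ∑ i ∈ Finset.range k,
      (Polynomial.X : S2) ^ (k - (i + 1)) • d (wS (2 * k) s (2 * i + 2)) =
        (Polynomial.X : S2) ^ k • wS (2 * k) s 1 := by
    have hsub := Finset.sum_range_sub
      (fun i => (Polynomial.X : S2) ^ (k - i) • wS (2 * k) s (2 * i + 1)) k
    rw [wS_of_lt s (by omega : 2 * k < 2 * k + 1), smul_zero, zero_sub] at hsub
    rw [neg_eq_self_of_module_S2] at hsub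
    refine Eq.trans (Finset.sum_congr rfl fun i hi => ?_) hsub
    have hi := Finset.mem_range.1 hi
    rw [h.map_even s i hi, smul_add, smul_smul, ← pow_succ,
      show k - (i + 1) + 1 = k - i by omega, add_comm, sub_eq_add_neg,
      neg_eq_self_of_module_S2]
    rfl
  simp only [freeCycle, map_add, map_smul, map_sum, tele, Fin.sum_univ_two, h.map_z0]
  rw [← smul_add]
  exact add_self_eq_zero_of_module_S2 (M := AB (2 * k) → S2) _

theorem homologyInvariant_comp (h : IsModelDifferential k d) (hk : 1 ≤ k) :
    homologyInvariant k ∘ₗ d = 0 := by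
  have h1 (s : Fin 2) : oddWeight k (wS (2 * k) s 1) = 1 := by
    simpa using oddWeight_odd s (i := 0) hk
  have hne : 2 * k ≠ 1 := by omega
  have hX := Submodule.mem_span_singleton_self (R := S2) (Polynomial.X : S2)
  refine AB.linearMap_ext ?_ ?_ ?_ ?_ ?_ (fun s i hi => ?_) (fun s i hi => ?_) <;>
    rw [LinearMap.comp_apply, LinearMap.zero_apply, homologyInvariant_eq_zero_iff]
  · simp [h.map_a]
  · rw [h.map_b]
    refine ⟨by simp, by simp, ?_⟩
    simpa only [Pi.smul_apply, Pi.single_eq_same, smul_eq_mul, mul_one] using hX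
  · rw [h.map_c]
    refine ⟨by simp, by simp, ?_⟩
    simpa only [Pi.smul_apply, Pi.single_eq_same, smul_eq_mul, mul_one] using hX
  · simp [h.map_e]
  · simp [h.map_z0, wCoord_wS, h1, hne, add_self_eq_zero_of_module_S2]
  · simp [h.map_odd s i hi]
  · have ne1 : 2 * k ≠ 2 * i + 1 := by omega
    have ne3 : 2 * k ≠ 2 * i + 3 := by omega
    rw [h.map_even s i hi]
    refine ⟨by simp [wCoord_wS, ne1, ne3], ?_, by simp⟩
    rw [map_add, map_smul, oddWeight_odd s hi, smul_eq_mul, ← pow_succ']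
    by_cases hik : i + 1 < k
    · have hnext := oddWeight_odd s hik
      rw [show 2 * (i + 1) + 1 = 2 * i + 3 by ring] at hnext
      rw [hnext, add_self_eq_zero_of_module_S2]
      exact Submodule.zero_mem _
    · rw [wS_of_lt s (by omega : 2 * k < 2 * i + 3), map_zero, add_zero,
        show i + 1 = k by omega]
      exact Submodule.mem_span_singleton_self _

theorem mk_odd (h : IsModelDifferential k d) (s : Fin 2) {i : ℕ} (hi : i ≤ k) :
    (LinearMap.range d).mkQ (wS (2 * k) s (2 * i + 1)) =
      (Polynomial.X : S2) ^ i • (LinearMap.range d).mkQ (wS (2 * k) 0 1) := by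
  have key (y) : (LinearMap.range d).mkQ (d y) = 0 :=
    (Submodule.Quotient.mk_eq_zero _).2 ⟨y, rfl⟩
  have eq_of_add {p q : (AB (2 * k) → S2) ⧸ LinearMap.range d} (hpq : p + q = 0) : q = p := by
    rw [← neg_eq_of_add_eq_zero_right hpq, neg_eq_self_of_module_S2]
  induction i with
  | zero =>
    have hz := key (Pi.single AB.z0 1)
    rw [h.map_z0, map_add] at hz
    fin_cases s
    · simp
    · simpa using eq_of_add hz
  | succ i ih =>
    have hw := key (wS (2 * k) s (2 * i + 2))
    rw [h.map_even s i (by omega), map_add, map_smul, ih (by omega), smul_smul,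
      ← pow_succ'] at hw
    exact eq_of_add hw

/-- Modulo boundaries, every chain is determined by its even coordinates, its `oddWeight` and its
coordinates in the span of `a, b, c, e` and `z_0`. -/
theorem mk_eq (h : IsModelDifferential k d) (x : AB (2 * k) → S2) :
    (LinearMap.range d).mkQ x =
      x AB.a • (LinearMap.range d).mkQ (Pi.single AB.a 1) +
      x AB.b • (LinearMap.range d).mkQ (Pi.single AB.b 1) +
      x AB.c • (LinearMap.range d).mkQ (Pi.single AB.c 1) +
      x AB.e • (LinearMap.range d).mkQ (Pi.single AB.e 1) +
      x AB.z0 • (LinearMap.range d).mkQ (Pi.single AB.z0 1) +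
      oddWeight k x • (LinearMap.range d).mkQ (wS (2 * k) 0 1) +
      ∑ s : Fin 2, ∑ i ∈ Finset.range k, wCoord (2 * k) s (2 * i + 2) x •
        (LinearMap.range d).mkQ (wS (2 * k) s (2 * i + 2)) := by
  let π := (LinearMap.range d).mkQ
  have hmap : π =
      (LinearMap.proj AB.a).smulRight (π (Pi.single AB.a 1)) +
      (LinearMap.proj AB.b).smulRight (π (Pi.single AB.b 1)) +
      (LinearMap.proj AB.c).smulRight (π (Pi.single AB.c 1)) +
      (LinearMap.proj AB.e).smulRight (π (Pi.single AB.e 1)) +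
      (LinearMap.proj AB.z0).smulRight (π (Pi.single AB.z0 1)) +
      (oddWeight k).smulRight (π (wS (2 * k) 0 1)) +
      ∑ s : Fin 2, ∑ i ∈ Finset.range k, (wCoord (2 * k) s (2 * i + 2)).smulRight
        (π (wS (2 * k) s (2 * i + 2))) := by
    refine AB.linearMap_ext ?_ ?_ ?_ ?_ ?_ (fun s i hi => ?_) (fun s i hi => ?_)
    · simp
    · simp
    · simp
    · simp
    · simp
    · have ne (j : ℕ) : 2 * j + 2 ≠ 2 * i + 1 := by omega
      simp only [LinearMap.add_apply, LinearMap.sum_apply, LinearMap.smulRight_apply,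
        LinearMap.proj_apply, wS_apply_a, wS_apply_b, wS_apply_c, wS_apply_e, wS_apply_z0,
        zero_smul, zero_add, oddWeight_odd s hi, wCoord_wS, ne, false_and, and_false,
        if_false, Finset.sum_const_zero, add_zero]
      exact h.mk_odd s hi.le
    · simp only [LinearMap.add_apply, LinearMap.sum_apply, LinearMap.smulRight_apply,
        LinearMap.proj_apply, wS_apply_a, wS_apply_b, wS_apply_c, wS_apply_e, wS_apply_z0,
        zero_smul, zero_add, oddWeight_even, wCoord_wS]
      rw [Finset.sum_eq_single s, Finset.sum_eq_single i]
      · rw [if_pos (by omega), one_smul]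
      · intro j _ hj
        rw [if_neg (by omega), zero_smul]
      · intro hn
        exact absurd (Finset.mem_range.2 hi) hn
      · intro t _ ht
        exact Finset.sum_eq_zero fun j _ => by rw [if_neg (fun hh => ht hh.1), zero_smul]
      · simp
  have := LinearMap.congr_fun hmap x
  simpa only [LinearMap.add_apply, LinearMap.sum_apply, LinearMap.smulRight_apply,
    LinearMap.proj_apply] using this

theorem wCoord_even_zero_eq_zero (h : IsModelDifferential k d) {x : AB (2 * k) → S2}
    (hx : d x = 0) (htop : wCoord (2 * k) 0 (2 * k) x = 0) {i : ℕ} (hi : i < k) :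
    wCoord (2 * k) 0 (2 * i + 2) x = 0 := by
  obtain ⟨n, hn⟩ : ∃ n, k = i + 1 + n := ⟨k - (i + 1), by omega⟩
  induction n generalizing i with
  | zero => rwa [show 2 * i + 2 = 2 * k by omega]
  | succ n ih =>
    have hstep := h.wCoord_odd 0 (by omega : i + 1 < k) x
    have hnext : wCoord (2 * k) 0 (2 * i + 4) x = 0 := ih (i := i + 1) (by omega) (by omega)
    rw [hx, map_zero, hnext, mul_zero, add_zero] at hstep
    exact hstep.symm

theorem mem_range (h : IsModelDifferential k d) (hk : 1 ≤ k) {x : AB (2 * k) → S2}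
    (hx : d x = 0) (hinv : homologyInvariant k x = 0) : x ∈ LinearMap.range d := by
  obtain ⟨htop, hodd, hxe⟩ := homologyInvariant_eq_zero_iff.1 hinv
  obtain ⟨q, hq⟩ := Submodule.mem_span_singleton.1 hodd
  obtain ⟨t, ht⟩ := Submodule.mem_span_singleton.1 hxe
  have hX : (Polynomial.X : S2) ≠ 0 := Polynomial.X_ne_zero
  have ha : x AB.a = 0 := by rw [← h.apply_b x, hx]; rfl
  have hbc : x AB.b + x AB.c = 0 := by
    have := h.apply_e x
    rw [hx, Pi.zero_apply] at this
    exact (mul_eq_zero.1 this.symm).resolve_left hX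
  have hcb : x AB.c = x AB.b := by
    rw [← neg_eq_of_add_eq_zero_right hbc, CharTwo.neg_eq]
  have heven0 : ∀ i < k, wCoord (2 * k) 0 (2 * i + 2) x = 0 := fun i hi =>
    h.wCoord_even_zero_eq_zero hx htop hi
  have hz : x AB.z0 = 0 := by
    have := h.wCoord_one hk 0 x
    rw [hx, map_zero, heven0 0 hk, mul_zero, add_zero] at this
    exact this.symm
  have heven1 : ∀ i < k, wCoord (2 * k) 1 (2 * i + 2) x = 0 := by
    intro i
    induction i with
    | zero =>
      intro _
      have := h.wCoord_one hk 1 x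
      rw [hx, map_zero, hz, zero_add] at this
      exact (mul_eq_zero.1 this.symm).resolve_left hX
    | succ i ih =>
      intro hi
      have := h.wCoord_odd 1 hi x
      rw [hx, map_zero, ih (by omega), zero_add] at this
      exact (mul_eq_zero.1 this.symm).resolve_left hX
  have key (y) : (LinearMap.range d).mkQ (d y) = 0 :=
    (Submodule.Quotient.mk_eq_zero _).2 ⟨y, rfl⟩
  have hka := key (Pi.single AB.a 1)
  rw [h.map_a, map_add] at hka
  have hkb := key (Pi.single AB.b 1)
  rw [h.map_b, map_smul] at hkb
  have hkw := h.mk_odd 0 le_rfl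
  rw [wS_of_lt 0 (by omega : 2 * k < 2 * k + 1), map_zero] at hkw
  refine (Submodule.Quotient.mk_eq_zero _).1 ((h.mk_eq x).trans ?_)
  rw [Fin.sum_univ_two, Finset.sum_eq_zero fun i hi => by
      rw [heven0 i (Finset.mem_range.1 hi), zero_smul],
    Finset.sum_eq_zero fun i hi => by rw [heven1 i (Finset.mem_range.1 hi), zero_smul],
    ha, hz, hcb, ← hq, ← ht, smul_assoc, smul_assoc, ← hkw, hkb]
  simp only [zero_smul, smul_zero, add_zero, zero_add]
  rw [← smul_add, hka, smul_zero]

theorem homologyInvariant_surjective_on_ker (h : IsModelDifferential k d) (hk : 1 ≤ k) :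
    Function.Surjective (homologyInvariant k ∘ₗ (LinearMap.ker d).subtype) := by
  rintro ⟨p, q, r⟩
  obtain ⟨q, rfl⟩ := Submodule.mkQ_surjective _ q
  obtain ⟨r, rfl⟩ := Submodule.mkQ_surjective _ r
  have h1 : d (wS (2 * k) 0 1) = 0 := h.map_wS_two_mul_add_one 0 0
  have hw : oddWeight k (wS (2 * k) 0 1) = 1 := by
    simpa using oddWeight_odd 0 (i := 0) hk
  have hne : 2 * k ≠ 1 := by omega
  refine ⟨⟨p • freeCycle k + q • wS (2 * k) 0 1 + r • Pi.single AB.e 1, ?_⟩, ?_⟩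
  · rw [LinearMap.mem_ker, map_add, map_add, map_smul, map_smul, map_smul, h.map_freeCycle, h1,
      h.map_e]
    simp
  · refine Prod.ext ?_ (Prod.ext (congrArg Submodule.Quotient.mk ?_)
      (congrArg Submodule.Quotient.mk ?_))
    · change wCoord (2 * k) 0 (2 * k) _ = p
      simp [wCoord_freeCycle hk, wCoord_wS, hne]
    · change oddWeight k _ = q
      simp [oddWeight_freeCycle, hw]
    · change (p • freeCycle k + q • wS (2 * k) 0 1 + r • Pi.single AB.e 1 :
        AB (2 * k) → S2) AB.e = r
      simp [freeCycle_apply_e]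

theorem ker_homologyInvariant (h : IsModelDifferential k d) (hk : 1 ≤ k) :
    LinearMap.ker (homologyInvariant k ∘ₗ (LinearMap.ker d).subtype) =
      Submodule.comap (LinearMap.ker d).subtype (LinearMap.range d) := by
  ext ⟨x, hx⟩
  refine ⟨fun hinv => h.mem_range hk hx hinv, ?_⟩
  rintro ⟨y, hy⟩
  rw [LinearMap.mem_ker, LinearMap.comp_apply, ← hy]
  exact LinearMap.congr_fun (h.homologyInvariant_comp hk) y

end IsModelDifferential

/-- Let `A` be the free `F₂[U]`-module on `{e, a, b, c, z_0} ∪ {w_r^s : 1 ≤ r ≤ v, s ∈ {1,2}}`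
(`v = 2k`, `k ≥ 1`) with differential `∂a = b + c`, `∂b = ∂c = U • e`, `∂z_0 = w_1^1 + w_1^2`,
`∂w_r^s = U • w_{r-1}^s + w_{r+1}^s` for even `r` with `0 < r < v`, `∂w_v^s = U • w_{v-1}^s`,
and `∂ = 0` on `e` and on `w_r^s` for odd `r`. Then `∂ ∘ ∂ = 0` and the homology
`ker ∂ / range ∂` is isomorphic as an `F₂[U]`-module to
`F₂[U] ⊕ F₂[U]/(U^k) ⊕ F₂[U]/(U)`. -/
theorem modelC1_Aminus_homology (k : ℕ) (hk : 1 ≤ k) (v : ℕ) (hv : v = 2 * k)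
    (d : (AB v → S2) →ₗ[S2] (AB v → S2))
    (hda : d (Pi.single AB.a 1) = Pi.single AB.b 1 + Pi.single AB.c 1)
    (hdb : d (Pi.single AB.b 1) = (Polynomial.X : S2) • (Pi.single AB.e 1 : AB v → S2))
    (hdc : d (Pi.single AB.c 1) = (Polynomial.X : S2) • (Pi.single AB.e 1 : AB v → S2))
    (hdz0 : d (Pi.single AB.z0 1) = wS v 0 1 + wS v 1 1)
    (hdweven : ∀ s : Fin 2, ∀ r : ℕ, 0 < r → r < v → Even r →
      d (wS v s r) = (Polynomial.X : S2) • wS v s (r - 1) + wS v s (r + 1))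
    (hdwv : ∀ s : Fin 2, d (wS v s v) = (Polynomial.X : S2) • wS v s (v - 1))
    (hde : d (Pi.single AB.e 1) = 0)
    (hdwodd : ∀ s : Fin 2, ∀ r : ℕ, 1 ≤ r → r ≤ v → Odd r → d (wS v s r) = 0) :
    d ∘ₗ d = 0 ∧
    Nonempty (
      (↥(LinearMap.ker d) ⧸
        Submodule.comap (LinearMap.ker d).subtype (LinearMap.range d)) ≃ₗ[S2]
      (S2 × (S2 ⧸ Submodule.span S2 {(Polynomial.X : S2) ^ k}) ×
        (S2 ⧸ Submodule.span S2 {(Polynomial.X : S2)}))) := by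
  subst hv
  have h : IsModelDifferential k d :=
    { map_a := hda
      map_b := hdb
      map_c := hdc
      map_e := hde
      map_z0 := hdz0
      map_odd := fun s i hi => hdwodd s _ (by omega) (by omega) (odd_two_mul_add_one i)
      map_even := fun s i hi => by
        by_cases hik : i + 1 < k
        · exact hdweven s _ (by omega) (by omega) ⟨i + 1, by ring⟩
        · obtain rfl : k = i + 1 := by omega
          rw [wS_of_lt s (by omega : 2 * (i + 1) < 2 * i + 3), add_zero]
          exact hdwv s }
  exact ⟨h.comp_self, ⟨(Submodule.quotEquivOfEq _ _ (h.ker_homologyInvariant hk).symm).trans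
    (LinearMap.quotKerEquivOfSurjective _ (h.homologyInvariant_surjective_on_ker hk))⟩⟩
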